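/- arXiv:2601.03503 — 5 statements merged into one kernel-verified Lean document; each statement's English description precedes it below -/
import Mathlib

section
/- Let G be an abelian group, F a field, and A a G-graded algebra over F. For nonzero elements x, y of the group semiring Z_{\geq 0}G (i.e., finite multisets in G), the matrix algebra M_x(M_y(A)) with the grading induced by choosing tuples representing x and y is isomorphic as a G-graded algebra to M_{xy}(A). -/
noncomputable section

open scoped TensorProduct

/-- A `G`-grading on the `F`-algebra `A`: the components multiply according to the group law,
`1` is homogeneous of trivial degree, and `A` is the internal direct sum of the components. -/
def IsGrading (F : Type) [Field F] {G : Type} [CommGroup G] [DecidableEq G]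
    {A : Type} [Ring A] [Algebra F A] (𝒜 : G → Submodule F A) : Prop :=
  (1 : A) ∈ 𝒜 1 ∧
  (∀ {g h : G} {a b : A}, a ∈ 𝒜 g → b ∈ 𝒜 h → a * b ∈ 𝒜 (g * h)) ∧
  DirectSum.IsInternal 𝒜

/-- Isomorphism of `G`-graded algebras: an algebra isomorphism matching up the
homogeneous components. -/
def IsGradedAlgIso (F : Type) [Field F] {G : Type} [CommGroup G]
    {A B : Type} [Ring A] [Algebra F A] [Ring B] [Algebra F B]
    (𝒜 : G → Submodule F A) (ℬ : G → Submodule F B) : Prop :=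
  ∃ e : A ≃ₐ[F] B, ∀ g, (𝒜 g).map e.toLinearMap = ℬ g

/-- A homomorphism of graded algebras: it maps each component into the corresponding one. -/
def IsGradedHom (F : Type) [Field F] {G : Type} [CommGroup G]
    {A B : Type} [Ring A] [Algebra F A] [Ring B] [Algebra F B]
    (𝒜 : G → Submodule F A) (ℬ : G → Submodule F B) (f : A →ₐ[F] B) : Prop :=
  ∀ g, (𝒜 g).map f.toLinearMap ≤ ℬ g

/-- The `G`-grading on the matrix algebra `M_ι(A)` induced by a tuple `γ : ι → G` and the
grading `𝒜` of `A`: `deg (E i j a) = γ i * deg a * (γ j)⁻¹`. -/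
def matrixGrading {F : Type} [Field F] {G : Type} [CommGroup G]
    {A : Type} [Ring A] [Algebra F A] {ι : Type} (γ : ι → G)
    (𝒜 : G → Submodule F A) (g : G) : Submodule F (Matrix ι ι A) where
  carrier := {M | ∀ i j, M i j ∈ 𝒜 ((γ i)⁻¹ * g * γ j)}
  add_mem' := fun hM hN i j => add_mem (hM i j) (hN i j)
  zero_mem' := fun i j => zero_mem _
  smul_mem' := fun c M hM i j => Submodule.smul_mem _ c (hM i j)

/-- The trivial grading on the base field. -/
def trivGrading (F : Type) [Field F] (G : Type) [CommGroup G] [DecidableEq G]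
    (g : G) : Submodule F F :=
  if g = 1 then ⊤ else ⊥

/-- The elementary grading on a matrix algebra over `F` determined by the tuple `γ`. -/
def elemGrading {F : Type} [Field F] {G : Type} [CommGroup G] [DecidableEq G]
    {ι : Type} (γ : ι → G) : G → Submodule F (Matrix ι ι F) :=
  matrixGrading γ (trivGrading F G)

/-- `γ` is a tuple representing the multiset `x` of elements of `G`. -/
def Reps {G : Type} [CommGroup G] {n : ℕ} (γ : Fin n → G) (x : Multiset G) : Prop :=
  Multiset.map γ Finset.univ.val = x

/-- Product of multisets of group elements, corresponding to the product in the
group semiring `ℤ≥0 G`. -/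
def mmul {G : Type} [CommGroup G] (x y : Multiset G) : Multiset G :=
  x.bind fun g => y.map (g * ·)

/-- The image of a multiset under `g ↦ g⁻¹`, corresponding to the bar involution of `ℤG`. -/
def mbarM {G : Type} [CommGroup G] (x : Multiset G) : Multiset G :=
  x.map fun g => g⁻¹

/-- The grading of a tensor product of graded algebras: `deg (a ⊗ b) = deg a * deg b`. -/
def tensorGrading (F : Type) [Field F] {G : Type} [CommGroup G]
    {A B : Type} [Ring A] [Algebra F A] [Ring B] [Algebra F B]
    (𝒜 : G → Submodule F A) (ℬ : G → Submodule F B) (g : G) : Submodule F (A ⊗[F] B) :=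
  ⨆ p : {p : G × G // p.1 * p.2 = g},
    Submodule.map₂ (TensorProduct.mk F A B) (𝒜 p.1.1) (ℬ p.1.2)

/-- The grading induced on a subalgebra (e.g. a centralizer) of a graded algebra. -/
def subGrading {F : Type} [Field F] {G : Type} [CommGroup G]
    {B : Type} [Ring B] [Algebra F B] (C : Subalgebra F B)
    (ℬ : G → Submodule F B) (g : G) : Submodule F C :=
  (ℬ g).comap C.val.toLinearMap

/-- The grading on the opposite algebra, with the same homogeneous components. -/
def opGrading {F : Type} [Field F] {G : Type} [CommGroup G]
    {A : Type} [Ring A] [Algebra F A] (𝒜 : G → Submodule F A) (g : G) : Submodule F Aᵐᵒᵖ :=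
  (𝒜 g).map (MulOpposite.opLinearEquiv F).toLinearMap

/-- The grading on `End_F(A)` induced by a grading of `A`: a map is homogeneous of degree `g`
if it maps `A_h` into `A_{g h}` for all `h`. -/
def endGrading {F : Type} [Field F] {G : Type} [CommGroup G]
    {A : Type} [Ring A] [Algebra F A] (𝒜 : G → Submodule F A) (g : G) :
    Submodule F (Module.End F A) where
  carrier := {f | ∀ h : G, ∀ a ∈ 𝒜 h, f a ∈ 𝒜 (g * h)}
  add_mem' := fun hf hf' h a ha => add_mem (hf h a ha) (hf' h a ha)
  zero_mem' := fun _ _ _ => zero_mem _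
  smul_mem' := fun c f hf h a ha => Submodule.smul_mem _ c (hf h a ha)

/-- The `G`-grading on an iterated matrix algebra is the grading of the matrix algebra over the
product index type for the tuple of products, along any enumeration of that index type. -/
theorem isGradedAlgIso_matrixGrading_of_equiv {F : Type} [Field F] {G : Type} [CommGroup G]
    {A : Type} [Ring A] [Algebra F A] (𝒜 : G → Submodule F A)
    {ι κ μ : Type} [Fintype ι] [Fintype κ] [Fintype μ]
    [DecidableEq ι] [DecidableEq κ] [DecidableEq μ]
    (γ : ι → G) (δ : κ → G) (ε : μ → G) (e : ι × κ ≃ μ)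
    (he : ∀ p, ε (e p) = γ p.1 * δ p.2) :
    IsGradedAlgIso F (matrixGrading γ (matrixGrading δ 𝒜)) (matrixGrading ε 𝒜) := by
  let φ := (Matrix.compAlgEquiv ι κ A F).trans (Matrix.reindexAlgEquiv F A e)
  have key : ∀ g M, φ M ∈ matrixGrading ε 𝒜 g ↔
      M ∈ matrixGrading γ (matrixGrading δ 𝒜) g := by
    intro g M
    have degree_eq : ∀ i j k l, (ε (e (i, k)))⁻¹ * g * ε (e (j, l)) =
        (δ k)⁻¹ * ((γ i)⁻¹ * g * γ j) * δ l := by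
      intro i j k l
      simp only [he, mul_inv]
      ac_rfl
    constructor
    · intro h i j k l
      have := h (e (i, k)) (e (j, l))
      rw [degree_eq] at this
      simpa [φ] using this
    · intro h p q
      obtain ⟨⟨i, k⟩, rfl⟩ := e.surjective p
      obtain ⟨⟨j, l⟩, rfl⟩ := e.surjective q
      rw [degree_eq]
      simpa [φ] using h i j k l
  refine ⟨φ, fun g => ?_⟩
  ext M
  constructor
  · rintro ⟨N, hN, rfl⟩
    exact (key g N).2 hN
  · intro hM
    exact ⟨φ.symm M, (key g _).1 (by simpa using hM), by simp⟩

/-- Two families indexed by finite types with the same multiset of values agree up to a bijection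
of the index types. -/
theorem exists_equiv_of_map_univ_eq {α β γ : Type*} [Fintype α] [Fintype β]
    (f : α → γ) (g : β → γ)
    (h : Multiset.map f Finset.univ.val = Multiset.map g Finset.univ.val) :
    ∃ e : α ≃ β, ∀ a, g (e a) = f a := by
  classical
  have card_eq : ∀ c, Fintype.card {a // f a = c} = Fintype.card {b // g b = c} := by
    intro c
    have hc := congrArg (Multiset.count c) h
    simp only [Multiset.count_map, ← Finset.filter_val, Finset.card_val] at hc
    simpa only [Fintype.card_subtype, eq_comm] using hc
  exact ⟨Equiv.ofFiberEquiv fun c => Fintype.equivOfCardEq (card_eq c),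
    fun a => Equiv.ofFiberEquiv_map _ a⟩

/-- The product of two multisets is represented by the tuple of pairwise products. -/
theorem mmul_eq_map_univ {G : Type} [CommGroup G] {n m : ℕ} {x y : Multiset G}
    {γ : Fin n → G} {δ : Fin m → G} (hγ : Reps γ x) (hδ : Reps δ y) :
    mmul x y = Multiset.map (fun p : Fin n × Fin m => γ p.1 * δ p.2) Finset.univ.val := by
  rw [← hγ, ← hδ, ← Finset.univ_product_univ, Finset.product_val]
  simp [mmul, Multiset.bind_map, SProd.sprod, Multiset.product, Multiset.map_bind]
  rfl

/-- For a `G`-graded algebra `A` over a field `F` and nonzero multisets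
`x`, `y` in `G`, the iterated matrix algebra `M_x(M_y(A))` is isomorphic as a `G`-graded
algebra to `M_{xy}(A)`. -/
theorem matrix_matrix_graded_iso {F : Type} [Field F] {G : Type} [CommGroup G] [DecidableEq G]
    {A : Type} [Ring A] [Algebra F A] (𝒜 : G → Submodule F A) (h𝒜 : IsGrading F 𝒜)
    {x y : Multiset G} (hx : x ≠ 0) (hy : y ≠ 0)
    {n m k : ℕ} (γ : Fin n → G) (δ : Fin m → G) (ε : Fin k → G)
    (hγ : Reps γ x) (hδ : Reps δ y) (hε : Reps ε (mmul x y)) :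
    IsGradedAlgIso F (matrixGrading γ (matrixGrading δ 𝒜)) (matrixGrading ε 𝒜) := by
  obtain ⟨e, he⟩ := exists_equiv_of_map_univ_eq (fun p : Fin n × Fin m => γ p.1 * δ p.2) ε
    ((mmul_eq_map_univ hγ hδ).symm.trans hε.symm)
  exact isGradedAlgIso_matrixGrading_of_equiv 𝒜 γ δ ε e he
end
end

section
/- Let G be an abelian group and F a field. If A is a central simple F-algebra equipped with a G-grading, then the opposite algebra A^{op}, graded with the same homogeneous components, satisfies A \otimes A^{op} \cong End_F(A) as G-graded algebras, where End_F(A) is graded by declaring a nonzero linear map f homogeneous of degree g if f(A_h) \subseteq A_{gh} for all h in G. -/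
noncomputable section

open scoped TensorProduct

/-- A simple ring is a simple module over its enveloping algebra. -/
theorem isSimpleModule_tensorProduct_mulOpposite (F A : Type*) [Field F] [Ring A] [Algebra F A]
    [IsSimpleRing A] :
    letI : Module (A ⊗[F] Aᵐᵒᵖ) A := TensorProduct.Algebra.module
    IsSimpleModule (A ⊗[F] Aᵐᵒᵖ) A := by
  let : Module (A ⊗[F] Aᵐᵒᵖ) A := TensorProduct.Algebra.module
  have smul_tmul (a : A) (b : Aᵐᵒᵖ) (x : A) : (a ⊗ₜ[F] b) • x = a * x * b.unop :=
    AlgHom.mulLeftRight_apply F A a b x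
  rw [isSimpleModule_iff_toSpanSingleton_surjective]
  refine ⟨inferInstance, fun x hx ↦ ?_⟩
  rw [← LinearMap.range_eq_top]
  set N := LinearMap.range (LinearMap.toSpanSingleton (A ⊗[F] Aᵐᵒᵖ) A x)
  have hxN : x ∈ N := ⟨1, by simp⟩
  let I : TwoSidedIdeal A := TwoSidedIdeal.mk' (N : Set A) N.zero_mem N.add_mem N.neg_mem
    (fun {a y} hy ↦ by simpa [smul_tmul] using N.smul_mem (a ⊗ₜ[F] 1) hy)
    (fun {y a} hy ↦ by simpa [smul_tmul] using N.smul_mem (1 ⊗ₜ[F] MulOpposite.op a) hy)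
  have h1 : (1 : A) ∈ N :=
    (TwoSidedIdeal.mem_mk' ..).1 (IsSimpleRing.one_mem_of_ne_zero_mem I hx
      ((TwoSidedIdeal.mem_mk' ..).2 hxN))
  refine (Submodule.eq_top_iff').2 fun a ↦ ?_
  simpa [smul_tmul] using N.smul_mem (a ⊗ₜ[F] 1) h1

/-- Endomorphisms of a central algebra as a bimodule over itself are scalars. -/
theorem exists_smul_eq_of_end_tensorProduct_mulOpposite (F A : Type*) [Field F] [Ring A]
    [Algebra F A] [Algebra.IsCentral F A] :
    letI : Module (A ⊗[F] Aᵐᵒᵖ) A := TensorProduct.Algebra.module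
    ∀ φ : Module.End (A ⊗[F] Aᵐᵒᵖ) A, ∃ c : F, ∀ x, φ x = c • x := by
  let : Module (A ⊗[F] Aᵐᵒᵖ) A := TensorProduct.Algebra.module
  intro φ
  have smul_tmul (a : A) (b : Aᵐᵒᵖ) (x : A) : (a ⊗ₜ[F] b) • x = a * x * b.unop :=
    AlgHom.mulLeftRight_apply F A a b x
  have hl (a : A) : φ a = a * φ 1 := by
    simpa [smul_tmul] using φ.map_smul (a ⊗ₜ[F] 1) 1
  have hr (a : A) : φ a = φ 1 * a := by
    simpa [smul_tmul] using φ.map_smul (1 ⊗ₜ[F] MulOpposite.op a) 1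
  have hc : φ 1 ∈ Subalgebra.center F A :=
    Subalgebra.mem_center_iff.2 fun a ↦ (hl a).symm.trans (hr a)
  obtain ⟨c, hc⟩ := Algebra.mem_bot.1 (Algebra.IsCentral.out hc)
  exact ⟨c, fun x ↦ by rw [hr, ← hc, Algebra.smul_def]⟩

/-- For a finite-dimensional central simple algebra `A`, the canonical map
`A ⊗ Aᵐᵒᵖ → End A` is bijective. -/
theorem AlgHom.mulLeftRight_bijective_of_isCentral_of_isSimpleRing (F A : Type*) [Field F]
    [Ring A] [Algebra F A] [Algebra.IsCentral F A] [IsSimpleRing A] [FiniteDimensional F A] :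
    Function.Bijective (AlgHom.mulLeftRight F A) := by
  have hsurj : Function.Surjective (AlgHom.mulLeftRight F A) := by
    let : Module (A ⊗[F] Aᵐᵒᵖ) A := TensorProduct.Algebra.module
    have := isSimpleModule_tensorProduct_mulOpposite F A
    intro f
    let f' : Module.End (Module.End (A ⊗[F] Aᵐᵒᵖ) A) A :=
      { toFun := f
        map_add' := f.map_add
        map_smul' := fun φ x ↦ by
          obtain ⟨c, hc⟩ := exists_smul_eq_of_end_tensorProduct_mulOpposite F A φ
          simp [hc] }
    obtain ⟨s, hs⟩ := Module.Finite.fg_top (R := F) (M := A)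
    obtain ⟨r, hr⟩ := jacobson_density f' s
    exact ⟨r, LinearMap.ext_on hs fun m hm ↦ (hr m hm).symm⟩
  have hdim : Module.finrank F (A ⊗[F] Aᵐᵒᵖ) = Module.finrank F (Module.End F A) := by
    rw [Module.finrank_tensorProduct, Module.finrank_linearMap,
      (MulOpposite.opLinearEquiv F (M := A)).finrank_eq]
  exact ⟨(LinearMap.injective_iff_surjective_of_finrank_eq_finrank hdim
    (f := (AlgHom.mulLeftRight F A).toLinearMap)).2 hsurj, hsurj⟩

/-- A family spanning the whole lattice and lying below an independent family equals it. -/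
theorem iSupIndep.eq_of_le_of_iSup_eq_top {ι α : Type*} [CompleteLattice α] [IsModularLattice α]
    {s t : ι → α} (ht : iSupIndep t) (hst : s ≤ t) (hs : ⨆ i, s i = ⊤) : s = t := by
  funext i
  have hdisj : (⨆ (j) (_ : j ≠ i), s j) ⊓ t i = ⊥ :=
    ((ht i).symm.mono_left (iSup₂_mono fun j _ ↦ hst j)).eq_bot
  have htop : s i ⊔ ⨆ (j) (_ : j ≠ i), s j = ⊤ := by
    rw [← top_le_iff, ← hs]
    refine iSup_le fun j ↦ ?_
    by_cases h : j = i
    · exact h ▸ le_sup_left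
    · exact le_sup_of_le_right (le_iSup₂_of_le j h le_rfl)
  calc s i = s i ⊔ (⨆ (j) (_ : j ≠ i), s j) ⊓ t i := by rw [hdisj, sup_bot_eq]
    _ = (s i ⊔ ⨆ (j) (_ : j ≠ i), s j) ⊓ t i := (sup_inf_assoc_of_le _ (hst i)).symm
    _ = t i := by rw [htop, top_inf_eq]

section Grading

variable {F : Type} [Field F] {G : Type} [CommGroup G] {A B : Type} [Ring A] [Algebra F A]
  [Ring B] [Algebra F B]

theorem iSup_tensorGrading {𝒜 : G → Submodule F A} {ℬ : G → Submodule F B}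
    (h𝒜 : ⨆ g, 𝒜 g = ⊤) (hℬ : ⨆ g, ℬ g = ⊤) : ⨆ g, tensorGrading F 𝒜 ℬ g = ⊤ := by
  rw [← top_le_iff, ← TensorProduct.map₂_mk_top_top_eq_top, ← h𝒜, ← hℬ,
    Submodule.map₂_iSup_left]
  refine iSup_le fun g ↦ ?_
  rw [Submodule.map₂_iSup_right]
  exact iSup_le fun h ↦ le_iSup_of_le (g * h) <|
    le_iSup_of_le (f := fun p : {p : G × G // p.1 * p.2 = g * h} ↦
      Submodule.map₂ (TensorProduct.mk F A B) (𝒜 p.1.1) (ℬ p.1.2)) ⟨(g, h), rfl⟩ le_rfl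

theorem iSup_opGrading {𝒜 : G → Submodule F A} (h𝒜 : ⨆ g, 𝒜 g = ⊤) :
    ⨆ g, opGrading 𝒜 g = ⊤ := by
  simp only [opGrading]
  rw [← Submodule.map_iSup, h𝒜, Submodule.map_top, LinearEquiv.range]

theorem iSupIndep_endGrading {𝒜 : G → Submodule F A} (hind : iSupIndep 𝒜)
    (htop : ⨆ g, 𝒜 g = ⊤) : iSupIndep (endGrading 𝒜) := by
  intro g
  rw [Submodule.disjoint_def]
  intro f hf hf'
  have hzero (h : G) : 𝒜 h ≤ LinearMap.ker f := fun a ha ↦ by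
    have hle : ⨆ (j) (_ : j ≠ g), endGrading 𝒜 j ≤
        (⨆ (k) (_ : k ≠ g * h), 𝒜 k).comap (LinearMap.applyₗ a) :=
      iSup₂_le fun j hj φ hφ ↦ Submodule.mem_comap.2 <|
        (le_iSup₂_of_le (f := fun k (_ : k ≠ g * h) ↦ 𝒜 k) (j * h)
          (fun e ↦ hj (mul_right_cancel e)) le_rfl) (hφ h a ha)
    exact Submodule.disjoint_def.1 (hind (g * h)) _ (hf h a ha) (hle hf')
  exact LinearMap.ker_eq_top.1 (top_le_iff.1 (htop ▸ iSup_le hzero))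

theorem map_mulLeftRight_tensorGrading_le {𝒜 : G → Submodule F A}
    (hmul : ∀ {g h : G} {a b : A}, a ∈ 𝒜 g → b ∈ 𝒜 h → a * b ∈ 𝒜 (g * h)) (g : G) :
    (tensorGrading F 𝒜 (opGrading 𝒜) g).map (AlgHom.mulLeftRight F A).toLinearMap ≤
      endGrading 𝒜 g := by
  rw [Submodule.map_le_iff_le_comap]
  refine iSup_le fun ⟨⟨p, q⟩, hpq⟩ ↦ Submodule.map₂_le.2 ?_
  rintro a ha _ ⟨b, hb, rfl⟩ h x hx
  have hmem := hmul (hmul ha hx) hb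
  rw [mul_right_comm, show p * q = g from hpq] at hmem
  simpa using hmem

end Grading

/-- If `A` is a (finite-dimensional) central simple `F`-algebra with a
`G`-grading, then `A ⊗ A^op`, with the opposite algebra graded by the same homogeneous
components, is isomorphic as a `G`-graded algebra to `End_F(A)` with its induced grading. -/
theorem tensor_op_graded_iso_end {F : Type} [Field F] {G : Type} [CommGroup G] [DecidableEq G]
    {A : Type} [Ring A] [Algebra F A] [Algebra.IsCentral F A] [IsSimpleRing A]
    [FiniteDimensional F A]
    (𝒜 : G → Submodule F A) (h𝒜 : IsGrading F 𝒜) :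
    IsGradedAlgIso F (tensorGrading F 𝒜 (opGrading 𝒜)) (endGrading 𝒜) := by
  obtain ⟨-, hmul, hint⟩ := h𝒜
  have htop := hint.submodule_iSup_eq_top
  let e := AlgEquiv.ofBijective (AlgHom.mulLeftRight F A)
    (AlgHom.mulLeftRight_bijective_of_isCentral_of_isSimpleRing F A)
  refine ⟨e, congrFun ?_⟩
  refine (iSupIndep_endGrading hint.submodule_iSupIndep htop).eq_of_le_of_iSup_eq_top
    (map_mulLeftRight_tensorGrading_le hmul) ?_
  rw [← Submodule.map_iSup, iSup_tensorGrading htop (iSup_opGrading htop), Submodule.map_top]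
  exact LinearMap.range_eq_top.2 e.surjective
end
end

section
/- Let G be an abelian group and let B be a G-graded central simple algebra over a field F. Suppose iota and iota' are unital embeddings of a G-graded central simple algebra A into B. Then there exists a homogeneous invertible element b in B with iota' = Int(b) \circ iota if and only if the centralizers Cent_B(iota(A)) and Cent_B(iota'(A)) are isomorphic as G-graded algebras. -/
noncomputable section

open scoped TensorProduct

section CentralSimple

variable {F : Type*} [Field F] {A : Type*} [Ring A] [Algebra F A]
  [Algebra.IsCentral F A] [IsSimpleRing A]

/-- In a central simple algebra, elements that are linearly independent over the base field stay
independent over the multiplication algebra. -/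
theorem eq_zero_of_sum_mul_mul_eq_zero {κ : Type*} {v : κ → A} (hv : LinearIndependent F v)
    (s : Finset κ) :
    ∀ a : κ → A, (∀ z, ∑ j ∈ s, a j * z * v j = 0) → ∀ j ∈ s, a j = 0 := by
  classical
  induction s using Finset.induction_on with
  | empty => simp
  | insert k s hk ih =>
    let I : TwoSidedIdeal A := TwoSidedIdeal.mk'
      {x | ∃ a : κ → A, a k = x ∧ ∀ z, ∑ j ∈ insert k s, a j * z * v j = 0}
      ⟨0, by simp⟩
      (by
        rintro _ _ ⟨a, rfl, ha⟩ ⟨b, rfl, hb⟩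
        exact ⟨a + b, rfl, fun z => by
          simp only [Pi.add_apply, add_mul, Finset.sum_add_distrib, ha, hb, add_zero]⟩)
      (by
        rintro _ ⟨a, rfl, ha⟩
        exact ⟨-a, rfl, fun z => by
          simp only [Pi.neg_apply, neg_mul, Finset.sum_neg_distrib, ha, neg_zero]⟩)
      (by
        rintro x _ ⟨a, rfl, ha⟩
        exact ⟨fun j => x * a j, rfl, fun z => by
          simp only [mul_assoc, ← Finset.mul_sum] at ha ⊢
          rw [ha, mul_zero]⟩)
      (by
        rintro _ x ⟨a, rfl, ha⟩
        exact ⟨fun j => a j * x, rfl, fun z => by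
          simpa only [mul_assoc] using ha (x * z)⟩)
    have hI : I = ⊥ := by
      refine (eq_bot_or_eq_top I).resolve_right fun htop => ?_
      have h1 : (1 : A) ∈ I := htop ▸ trivial
      obtain ⟨a, hak, ha⟩ := (TwoSidedIdeal.mem_mk' _ _ _ _ _ _ _).1 h1
      have hcomm : ∀ j ∈ s, ∀ x, x * a j = a j * x := by
        intro j hj x
        refine sub_eq_zero.1 (ih (fun j => x * a j - a j * x) (fun z => ?_) j hj)
        have h₁ := ha (x * z)
        have h₂ := congrArg (x * ·) (ha z)
        simp only [Finset.sum_insert hk, hak, mul_add, Finset.mul_sum, one_mul, mul_zero] at h₁ h₂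
        rw [← sub_eq_zero.2 (h₂.trans h₁.symm)]
        simp only [sub_mul, Finset.sum_sub_distrib, mul_assoc]
        abel
      have hscalar : ∀ j, ∃ c : F, j ∈ insert k s → a j = algebraMap F A c := by
        intro j
        by_cases hj : j ∈ insert k s
        · obtain rfl | hj' := Finset.mem_insert.1 hj
          · exact ⟨1, fun _ => by rw [hak, map_one]⟩
          · obtain ⟨c, hc⟩ := Algebra.IsCentral.mem_center_iff F |>.1
              (Subalgebra.mem_center_iff.2 fun x => hcomm j hj' x)
            exact ⟨c, fun _ => hc⟩
        · exact ⟨0, fun h => absurd h hj⟩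
      choose c hc using hscalar
      have hck : c k = 0 := by
        refine linearIndependent_iff'.1 hv (insert k s) c ?_ k (Finset.mem_insert_self _ _)
        rw [← ha 1]
        exact Finset.sum_congr rfl fun j hj => by rw [hc j hj, mul_one, Algebra.smul_def]
      have := hc k (Finset.mem_insert_self _ _)
      rw [hak, hck, map_zero] at this
      exact one_ne_zero this
    intro a ha
    have hak : a k = 0 := by
      have : a k ∈ I := (TwoSidedIdeal.mem_mk' _ _ _ _ _ _ _).2 ⟨a, rfl, ha⟩
      rwa [hI, TwoSidedIdeal.mem_bot] at this
    intro j hj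
    obtain rfl | hj := Finset.mem_insert.1 hj
    · exact hak
    · exact ih a (fun z => by simpa [Finset.sum_insert hk, hak] using ha z) j hj

variable [FiniteDimensional F A]

/-- Every linear endomorphism of a finite-dimensional central simple algebra is given by
two-sided multiplications. -/
theorem exists_eq_sum_mul_mul {κ : Type*} [Fintype κ] (v : Module.Basis κ F A)
    (f : Module.End F A) : ∃ a : κ → A, ∀ z, f z = ∑ j, a j * z * v j := by
  let Φ : (κ → A) →ₗ[F] Module.End F A :=
    ∑ j, ((LinearMap.mul F A).flip (v j)).compRight F ∘ₗ LinearMap.mul F A ∘ₗ LinearMap.proj j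
  have hΦ : ∀ a z, Φ a z = ∑ j, a j * z * v j := fun a z => by
    simp [Φ, LinearMap.sum_apply]
  have hinj : Function.Injective Φ := by
    refine (injective_iff_map_eq_zero Φ).2 fun a ha => funext fun j => ?_
    exact eq_zero_of_sum_mul_mul_eq_zero v.linearIndependent Finset.univ a
      (fun z => by rw [← hΦ, ha, LinearMap.zero_apply]) j (Finset.mem_univ j)
  have hdim : Module.finrank F (κ → A) = Module.finrank F (Module.End F A) := by
    rw [Module.finrank_pi_fintype, Module.finrank_linearMap, Finset.sum_const,
      Finset.card_univ, smul_eq_mul, Module.finrank_eq_card_basis v]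
  obtain ⟨a, ha⟩ := (LinearMap.injective_iff_surjective_of_finrank_eq_finrank hdim).1 hinj f
  exact ⟨a, fun z => by rw [← ha, hΦ]⟩

/-- A finite-dimensional central simple algebra is Azumaya. -/
theorem isAzumaya_of_isCentral_of_isSimpleRing : IsAzumaya F A where
  eq_of_smul_eq_smul := eq_of_smul_eq_smul
  bij := by
    have hsurj : Function.Surjective (AlgHom.mulLeftRight F A) := fun f => by
      obtain ⟨a, ha⟩ := exists_eq_sum_mul_mul (Module.finBasis F A) f
      refine ⟨∑ j, a j ⊗ₜ MulOpposite.op (Module.finBasis F A j), LinearMap.ext fun z => ?_⟩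
      simp [ha, LinearMap.sum_apply]
    have hdim : Module.finrank F (A ⊗[F] Aᵐᵒᵖ) = Module.finrank F (Module.End F A) := by
      rw [Module.finrank_tensorProduct, Module.finrank_linearMap,
        (MulOpposite.opLinearEquiv F : A ≃ₗ[F] Aᵐᵒᵖ).finrank_eq]
    exact ⟨(LinearMap.injective_iff_surjective_of_finrank_eq_finrank
      (f := (AlgHom.mulLeftRight F A).toLinearMap) hdim).2 hsurj, hsurj⟩

variable {B : Type*} [Ring B] [Algebra F B]

/-- An algebra homomorphism `A → B` from a central simple algebra extends to an action of
`End_F(A)` on `B` compatible with left and right multiplications. -/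
theorem exists_end_algHom (ι : A →ₐ[F] B) :
    ∃ T : Module.End F A →ₐ[F] Module.End F B,
      (∀ a, T (LinearMap.mulLeft F a) = LinearMap.mulLeft F (ι a)) ∧
      (∀ a, T (LinearMap.mulRight F a) = LinearMap.mulRight F (ι a)) ∧
      ∀ f a, ∀ c ∈ Subalgebra.centralizer F (Set.range ι), T f (ι a * c) = ι (f a) * c := by
  have := isAzumaya_of_isCentral_of_isSimpleRing (F := F) (A := A)
  let E : A ⊗[F] Aᵐᵒᵖ ≃ₐ[F] Module.End F A :=
    AlgEquiv.ofBijective (AlgHom.mulLeftRight F A) IsAzumaya.bij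
  let ρ : A ⊗[F] Aᵐᵒᵖ →ₐ[F] Module.End F B :=
    (AlgHom.mulLeftRight F B).comp (Algebra.TensorProduct.map ι (AlgHom.op ι))
  have hE : ∀ x y z, E (x ⊗ₜ y) z = x * z * y.unop := fun x y z => by simp [E]
  have hρ : ∀ x y z, ρ (x ⊗ₜ y) z = ι x * z * ι y.unop := fun x y z => by simp [ρ]
  have key : ∀ t, (ρ.comp E.symm.toAlgHom) (E t) = ρ t := fun t => by simp
  refine ⟨ρ.comp E.symm.toAlgHom, fun a => ?_, fun a => ?_, fun f a c hc => ?_⟩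
  · have h : LinearMap.mulLeft F a = E (a ⊗ₜ 1) := LinearMap.ext fun z => by simp [hE]
    rw [h, key]
    exact LinearMap.ext fun z => by simp [hρ]
  · have h : LinearMap.mulRight F a = E (1 ⊗ₜ MulOpposite.op a) :=
      LinearMap.ext fun z => by simp [hE]
    rw [h, key]
    exact LinearMap.ext fun z => by simp [hρ]
  · obtain ⟨t, rfl⟩ := E.surjective f
    rw [key]
    induction t using TensorProduct.induction_on with
    | zero => simp
    | tmul x y =>
      have hcy := (Subalgebra.mem_centralizer_iff F).1 hc _ ⟨y.unop, rfl⟩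
      simp only [hE, hρ, map_mul, mul_assoc, hcy]
    | add t₁ t₂ h₁ h₂ => simp only [map_add, LinearMap.add_apply, h₁, h₂, add_mul]

/-- A basis of a central simple subalgebra is a basis of the whole algebra over the centralizer. -/
theorem exists_centralizer_coord {κ : Type*} [Fintype κ] (v : Module.Basis κ F A)
    (ι : A →ₐ[F] B) :
    ∃ q : κ → B →ₗ[F] Subalgebra.centralizer F (Set.range ι),
      (∀ y, ∑ k, ι (v k) * (q k y : B) = y) ∧
      ∀ k a (c : Subalgebra.centralizer F (Set.range ι)), q k (ι a * c) = v.repr a k • c := by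
  obtain ⟨T, hl, hr, hT⟩ := exists_end_algHom ι
  let P : κ → Module.End F A := fun k => (v.coord k).smulRight 1
  have hP : ∀ k y, T (P k) y ∈ Subalgebra.centralizer F (Set.range ι) := by
    rintro k y
    rw [Subalgebra.mem_centralizer_iff]
    rintro _ ⟨x, rfl⟩
    have h : LinearMap.mulLeft F x * P k = LinearMap.mulRight F x * P k :=
      LinearMap.ext fun z => by simp [P]
    have h' := LinearMap.congr_fun (congrArg T h) y
    simpa [hl, hr] using h'
  have hsum : ∑ k, LinearMap.mulLeft F (v k) * P k = 1 := LinearMap.ext fun z => by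
    simp [P, LinearMap.sum_apply, v.sum_repr]
  refine ⟨fun k => (T (P k)).codRestrict (Subalgebra.centralizer F (Set.range ι)).toSubmodule
    (hP k), fun y => ?_, fun k a c => Subtype.ext ?_⟩
  · have h := LinearMap.congr_fun (congrArg T hsum) y
    change ∑ k, ι (v k) * T (P k) y = y
    simpa [hl, LinearMap.sum_apply] using h
  · change T (P k) (ι a * c) = v.repr a k • (c : B)
    simpa [P] using hT (P k) a c c.2

/-- An element of a finite-dimensional simple algebra that is nonzero and satisfies `b B ⊆ B b`
is invertible. -/
theorem isUnit_of_forall_exists_mul_eq [IsSimpleRing B] [FiniteDimensional F B] {b : B}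
    (hb : b ≠ 0) (h : ∀ y, ∃ y', b * y = y' * b) : IsUnit b := by
  let I : TwoSidedIdeal B := TwoSidedIdeal.mk' {x | ∃ y, y * b = x}
    ⟨0, zero_mul b⟩
    (by rintro _ _ ⟨x, rfl⟩ ⟨y, rfl⟩; exact ⟨x + y, add_mul x y b⟩)
    (by rintro _ ⟨x, rfl⟩; exact ⟨-x, neg_mul x b⟩)
    (by rintro x _ ⟨y, rfl⟩; exact ⟨x * y, mul_assoc x y b⟩)
    (by
      rintro _ x ⟨y, rfl⟩
      obtain ⟨x', hx'⟩ := h x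
      exact ⟨y * x', by rw [mul_assoc, mul_assoc, hx']⟩)
  have hbI : b ∈ I := (TwoSidedIdeal.mem_mk' _ _ _ _ _ _ _).2 ⟨1, one_mul b⟩
  have htop : I = ⊤ := (eq_bot_or_eq_top I).resolve_left fun hbot =>
    hb ((TwoSidedIdeal.mem_bot B).1 (hbot ▸ hbI))
  have h1 : (1 : B) ∈ I := htop ▸ trivial
  obtain ⟨y, hy⟩ := (TwoSidedIdeal.mem_mk' _ _ _ _ _ _ _).1 h1
  have := IsArtinianRing.of_finite F B
  exact IsUnit.of_mul_eq_one y (mul_eq_one_symm hy)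

/-- Two embeddings of a central simple algebra together with an isomorphism of the centralizers
of their images are intertwined by a nonzero element. -/
theorem exists_ne_zero_intertwining [Algebra.IsCentral F B] [IsSimpleRing B]
    [FiniteDimensional F B] (ι ι' : A →ₐ[F] B)
    (e : Subalgebra.centralizer F (Set.range ι) ≃ₐ[F] Subalgebra.centralizer F (Set.range ι')) :
    ∃ b : B, b ≠ 0 ∧ (∀ a, b * ι a = ι' a * b) ∧
      ∀ c : Subalgebra.centralizer F (Set.range ι), b * c = e c * b := by
  let v := Module.finBasis F A
  obtain ⟨q, hq, hqc⟩ := exists_centralizer_coord v ι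
  let φ : Module.End F B := ∑ k, LinearMap.mulLeft F (ι' (v k)) ∘ₗ
    (Subalgebra.centralizer F (Set.range ι')).val.toLinearMap ∘ₗ e.toLinearMap ∘ₗ q k
  have hφ : ∀ a (c : Subalgebra.centralizer F (Set.range ι)), φ (ι a * c) = ι' a * e c := fun a c => by
    conv_rhs => rw [← v.sum_repr a]
    simp only [map_sum, map_smul, Finset.sum_mul, smul_mul_assoc]
    simp [φ, LinearMap.sum_apply, hqc]
  have hφι : ∀ a z, φ (ι a * z) = ι' a * φ z := fun a z => by
    rw [← hq z]
    simp only [Finset.mul_sum, map_sum, ← mul_assoc, ← map_mul, hφ]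
  have hφc : ∀ (c : Subalgebra.centralizer F (Set.range ι)) z, φ (c * z) = e c * φ z := by
    intro c z
    have h : ∀ x, (c : B) * ι x = ι x * c := fun x =>
      ((Subalgebra.mem_centralizer_iff F).1 c.2 _ ⟨x, rfl⟩).symm
    have h' : ∀ x, (e c : B) * ι' x = ι' x * e c := fun x =>
      ((Subalgebra.mem_centralizer_iff F).1 (e c).2 _ ⟨x, rfl⟩).symm
    rw [← hq z]
    simp only [Finset.mul_sum, map_sum, ← mul_assoc, h, hφ, h']
    simp only [mul_assoc, ← MulMemClass.coe_mul, hφ, map_mul]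
  let w := Module.finBasis F B
  obtain ⟨b, hb⟩ := exists_eq_sum_mul_mul w φ
  have hcoef : ∀ x x', (∀ z, φ (x * z) = x' * φ z) → ∀ j, b j * x = x' * b j := by
    intro x x' h j
    refine sub_eq_zero.1 (eq_zero_of_sum_mul_mul_eq_zero w.linearIndependent Finset.univ
      (fun j => b j * x - x' * b j) (fun z => ?_) j (Finset.mem_univ j))
    rw [← sub_eq_zero.2 (h z)]
    simp only [hb, Finset.mul_sum, sub_mul, Finset.sum_sub_distrib, mul_assoc]
  obtain ⟨j, hj⟩ : ∃ j, b j ≠ 0 := by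
    by_contra! h0
    have h := hφ 1 1
    simp [hb, h0] at h
  exact ⟨b j, hj, fun a => hcoef _ _ (hφι a) j, fun c => hcoef _ _ (hφc c) j⟩

/-- An element intertwining two embeddings and an isomorphism of the centralizers is invertible
as soon as it is nonzero. -/
theorem isUnit_of_intertwining [IsSimpleRing B] [FiniteDimensional F B] (ι ι' : A →ₐ[F] B)
    (e : Subalgebra.centralizer F (Set.range ι) ≃ₐ[F] Subalgebra.centralizer F (Set.range ι'))
    {b : B} (hb : b ≠ 0) (hι : ∀ a, b * ι a = ι' a * b)
    (hc : ∀ c : Subalgebra.centralizer F (Set.range ι), b * c = e c * b) :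
    IsUnit b := by
  obtain ⟨q, hq, -⟩ := exists_centralizer_coord (Module.finBasis F A) ι
  refine isUnit_of_forall_exists_mul_eq (F := F) hb fun y =>
    ⟨∑ k, ι' (Module.finBasis F A k) * e (q k y), ?_⟩
  conv_lhs => rw [← hq y]
  simp only [Finset.mul_sum, Finset.sum_mul, ← mul_assoc, hι]
  simp only [mul_assoc, hc]

end CentralSimple

section Grading

variable {F : Type*} [Field F] {G : Type*} [CommGroup G] [DecidableEq G]
  {B : Type*} [Ring B] [Algebra F B] {ℬ : G → Submodule F B} [DirectSum.Decomposition ℬ]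

open DirectSum

theorem coe_decompose_mul_left (hmul : ∀ {g h a b}, a ∈ ℬ g → b ∈ ℬ h → a * b ∈ ℬ (g * h))
    {h : G} {x : B} (hx : x ∈ ℬ h) (b : B) (g : G) :
    (decompose ℬ (x * b) (h * g) : B) = x * decompose ℬ b g := by
  induction b using Decomposition.inductionOn ℬ with
  | zero => simp
  | @homogeneous i m =>
    obtain rfl | hi := eq_or_ne i g
    · rw [decompose_of_mem_same ℬ (hmul hx m.2), decompose_of_mem_same ℬ m.2]
    · rw [decompose_of_mem_ne ℬ (hmul hx m.2) (by simpa using hi),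
        decompose_of_mem_ne ℬ m.2 hi, mul_zero]
  | add b₁ b₂ h₁ h₂ => simp [mul_add, h₁, h₂]

theorem coe_decompose_mul_right (hmul : ∀ {g h a b}, a ∈ ℬ g → b ∈ ℬ h → a * b ∈ ℬ (g * h))
    {h : G} {x : B} (hx : x ∈ ℬ h) (b : B) (g : G) :
    (decompose ℬ (b * x) (h * g) : B) = decompose ℬ b g * x := by
  induction b using Decomposition.inductionOn ℬ with
  | zero => simp
  | @homogeneous i m =>
    have hm : (m : B) * x ∈ ℬ (h * i) := mul_comm h i ▸ hmul m.2 hx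
    obtain rfl | hi := eq_or_ne i g
    · rw [decompose_of_mem_same ℬ hm, decompose_of_mem_same ℬ m.2]
    · rw [decompose_of_mem_ne ℬ hm (by simpa using hi), decompose_of_mem_ne ℬ m.2 hi, zero_mul]
  | add b₁ b₂ h₁ h₂ => simp [add_mul, h₁, h₂]

/-- If `b` intertwines two elements of the same degree, so do its homogeneous components. -/
theorem coe_decompose_mul_eq_mul_coe_decompose
    (hmul : ∀ {g h a b}, a ∈ ℬ g → b ∈ ℬ h → a * b ∈ ℬ (g * h))
    {h : G} {x y b : B} (hx : x ∈ ℬ h) (hy : y ∈ ℬ h) (hb : b * x = y * b) (g : G) :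
    (decompose ℬ b g : B) * x = y * decompose ℬ b g := by
  rw [← coe_decompose_mul_right hmul hx, hb, coe_decompose_mul_left hmul hy]

theorem units_inv_mem (hone : (1 : B) ∈ ℬ 1)
    (hmul : ∀ {g h a b}, a ∈ ℬ g → b ∈ ℬ h → a * b ∈ ℬ (g * h))
    {g : G} {u : Bˣ} (hu : (u : B) ∈ ℬ g) : (↑u⁻¹ : B) ∈ ℬ g⁻¹ := by
  have h := coe_decompose_mul_left hmul hu (↑u⁻¹ : B) g⁻¹
  rw [Units.mul_inv, mul_inv_cancel, decompose_of_mem_same ℬ hone] at h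
  rw [← mul_one (↑u⁻¹ : B), (Units.inv_mul_eq_iff_eq_mul u).2 h]
  exact SetLike.coe_mem _

end Grading

/-- Conjugation by a homogeneous unit carries the centralizer of the image of `ι` to that of the
conjugate embedding, preserving degrees. -/
theorem isGradedAlgIso_centralizer_of_conj {F : Type} [Field F] {G : Type} [CommGroup G]
    [DecidableEq G] {A B : Type} [Ring A] [Algebra F A] [Ring B] [Algebra F B]
    {ℬ : G → Submodule F B} [DirectSum.Decomposition ℬ] (hone : (1 : B) ∈ ℬ 1)
    (hmul : ∀ {g h a b}, a ∈ ℬ g → b ∈ ℬ h → a * b ∈ ℬ (g * h)) {ι ι' : A →ₐ[F] B}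
    {g : G} {u : Bˣ} (hu : (u : B) ∈ ℬ g) (hconj : ∀ a, ι' a = u * ι a * ↑u⁻¹) :
    IsGradedAlgIso F (subGrading (Subalgebra.centralizer F (Set.range ι)) ℬ)
      (subGrading (Subalgebra.centralizer F (Set.range ι')) ℬ) := by
  have huinv := units_inv_mem hone hmul hu
  let σ : B ≃ₐ[F] B := MulSemiringAction.toAlgEquiv F B (ConjAct.toConjAct u)
  have hσ : ∀ x, σ x = u * x * ↑u⁻¹ := fun x => rfl
  have hσ' : ∀ x, σ (↑u⁻¹ * x * u) = x := fun x => by simp [hσ, mul_assoc]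
  have hmap : (Subalgebra.centralizer F (Set.range ι)).map (σ : B →ₐ[F] B) =
      Subalgebra.centralizer F (Set.range ι') := by
    ext y
    obtain ⟨x, rfl⟩ := σ.surjective y
    have hmem : σ x ∈ (Subalgebra.centralizer F (Set.range ι)).map (σ : B →ₐ[F] B) ↔
        x ∈ Subalgebra.centralizer F (Set.range ι) := by simp [Subalgebra.mem_map]
    rw [hmem, Subalgebra.mem_centralizer_iff, Subalgebra.mem_centralizer_iff]
    simp only [Set.forall_mem_range, hconj, ← hσ, ← map_mul, σ.injective.eq_iff]
  refine ⟨(σ.subalgebraMap _).trans (Subalgebra.equivOfEq _ _ hmap), fun h => ?_⟩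
  ext y
  constructor
  · rintro ⟨x, hx, rfl⟩
    have := hmul (hmul hu hx) huinv
    rwa [mul_inv_cancel_comm] at this
  · intro hy
    have hmem : (↑u⁻¹ * y * u : B) ∈ Subalgebra.centralizer F (Set.range ι) := by
      obtain ⟨x, hx, hxy⟩ := hmap.ge y.2
      have hxy : (u : B) * x * ↑u⁻¹ = y := hxy
      rw [← hxy]
      rw [mul_assoc, Units.inv_mul_cancel_right, Units.inv_mul_cancel_left]
      exact hx
    refine ⟨⟨_, hmem⟩, ?_, Subtype.ext (hσ' y)⟩
    have := hmul (hmul huinv hy) hu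
    rwa [mul_assoc, mul_comm h g, inv_mul_cancel_left] at this

/-- (Graded Noether–Skolem criterion.) Two unital graded embeddings
`ι, ι' : A → B` of `G`-graded central simple algebras differ by conjugation by a homogeneous
invertible element of `B` if and only if the centralizers of their images, with the induced
gradings, are isomorphic as `G`-graded algebras. -/
theorem graded_embeddings_equivalent_iff_centralizers_iso
    {F : Type} [Field F] {G : Type} [CommGroup G] [DecidableEq G]
    {A B : Type} [Ring A] [Algebra F A] [Ring B] [Algebra F B]
    [Algebra.IsCentral F A] [IsSimpleRing A] [FiniteDimensional F A]
    [Algebra.IsCentral F B] [IsSimpleRing B] [FiniteDimensional F B]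
    (𝒜 : G → Submodule F A) (ℬ : G → Submodule F B)
    (h𝒜 : IsGrading F 𝒜) (hℬ : IsGrading F ℬ)
    (ι ι' : A →ₐ[F] B) (hinj : Function.Injective ι) (hinj' : Function.Injective ι')
    (hι : IsGradedHom F 𝒜 ℬ ι) (hι' : IsGradedHom F 𝒜 ℬ ι') :
    (∃ (g : G) (u : Bˣ), (u : B) ∈ ℬ g ∧ ∀ a : A, ι' a = u * ι a * ↑u⁻¹) ↔
      IsGradedAlgIso F
        (subGrading (Subalgebra.centralizer F (Set.range ι)) ℬ)
        (subGrading (Subalgebra.centralizer F (Set.range ι')) ℬ) := by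
  classical
  obtain ⟨hone, hmul, hint⟩ := hℬ
  let := hint.chooseDecomposition
  let := h𝒜.2.2.chooseDecomposition
  constructor
  · rintro ⟨g, u, hu, hconj⟩
    exact isGradedAlgIso_centralizer_of_conj hone hmul hu hconj
  · rintro ⟨e, he⟩
    have he' : ∀ {h} {c : Subalgebra.centralizer F (Set.range ι)},
        (c : B) ∈ ℬ h → (e c : B) ∈ ℬ h := fun {h c} hc =>
      (he h).le (Submodule.mem_map_of_mem hc)
    obtain ⟨b, hb0, hbι, hbc⟩ := exists_ne_zero_intertwining ι ι' e
    obtain ⟨g, hg⟩ : ∃ g, (DirectSum.decompose ℬ b g : B) ≠ 0 := by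
      by_contra! h0
      refine hb0 ((DirectSum.decompose ℬ).injective ?_)
      ext g
      simpa using h0 g
    have hgι : ∀ a, (DirectSum.decompose ℬ b g : B) * ι a = ι' a * DirectSum.decompose ℬ b g := by
      intro a
      induction a using DirectSum.Decomposition.inductionOn 𝒜 with
      | zero => simp
      | homogeneous m =>
        exact coe_decompose_mul_eq_mul_coe_decompose hmul (hι _ (Submodule.mem_map_of_mem m.2))
          (hι' _ (Submodule.mem_map_of_mem m.2)) (hbι m) g
      | add a₁ a₂ h₁ h₂ => simp only [map_add, mul_add, add_mul, h₁, h₂]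
    have hgc : ∀ c : Subalgebra.centralizer F (Set.range ι),
        (DirectSum.decompose ℬ b g : B) * c = e c * DirectSum.decompose ℬ b g := by
      intro c
      have hmem : ∀ h, (DirectSum.decompose ℬ (c : B) h : B) ∈
          Subalgebra.centralizer F (Set.range ι) := by
        intro h
        rw [Subalgebra.mem_centralizer_iff]
        rintro _ ⟨a, rfl⟩
        induction a using DirectSum.Decomposition.inductionOn 𝒜 with
        | zero => simp
        | homogeneous m =>
          have hm := hι _ (Submodule.mem_map_of_mem m.2)
          exact (coe_decompose_mul_eq_mul_coe_decompose hmul hm hm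
            ((Subalgebra.mem_centralizer_iff F).1 c.2 _ ⟨m, rfl⟩).symm h).symm
        | add a₁ a₂ h₁ h₂ => simp only [map_add, mul_add, add_mul, h₁, h₂]
      have hc : ∑ h ∈ (DirectSum.decompose ℬ (c : B)).support,
          (⟨DirectSum.decompose ℬ (c : B) h, hmem h⟩ : Subalgebra.centralizer F (Set.range ι)) = c := by
        refine Subtype.ext ?_
        rw [AddSubmonoidClass.coe_finsetSum]
        exact DirectSum.sum_support_decompose ℬ (c : B)
      rw [← hc, map_sum, AddSubmonoidClass.coe_finsetSum, AddSubmonoidClass.coe_finsetSum,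
        Finset.mul_sum, Finset.sum_mul]
      refine Finset.sum_congr rfl fun h _ => ?_
      exact coe_decompose_mul_eq_mul_coe_decompose hmul (SetLike.coe_mem _)
        (he' (SetLike.coe_mem _)) (hbc ⟨_, hmem h⟩) g
    obtain ⟨u, hu⟩ := isUnit_of_intertwining ι ι' e hg hgι hgc
    refine ⟨g, u, hu ▸ SetLike.coe_mem _, fun a => ?_⟩
    rw [Units.eq_mul_inv_iff_mul_eq, hu, hgι]
end
end

section
/- Let G be an abelian group and let (A_j, iota_{ji}) be a direct system over the natural numbers of G-graded associative unital algebras with unital embeddings. Suppose iota'_{ji} are embeddings with iota'_{ji} = Int(b_{ji}) \circ iota_{ji} for homogeneous invertible elements b_{ji} in A_j, for all i \leq j. Then the direct limit of (A_j, iota_{ji}) is isomorphic as a G-graded algebra to the direct limit of (A_j, iota'_{ji}). -/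
noncomputable section

open scoped TensorProduct

/-- `(L, ℒ)` is a direct limit of the chain of unital graded embeddings
`ι i : A i → A (i+1)`: there are compatible injective unital graded homomorphisms
`φ i : A i → L` whose images exhaust `L` as well as each homogeneous component of `L`. -/
def IsGradedDirectLimit (F : Type) [Field F] {G : Type} [CommGroup G]
    (A : ℕ → Type) [∀ i, Ring (A i)] [∀ i, Algebra F (A i)]
    (𝒜 : ∀ i, G → Submodule F (A i)) (ι : ∀ i, A i →ₐ[F] A (i + 1))
    {L : Type} [Ring L] [Algebra F L] (ℒ : G → Submodule F L) : Prop :=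
  ∃ φ : ∀ i, A i →ₐ[F] L,
    (∀ i, Function.Injective (φ i)) ∧
    (∀ i, (φ (i + 1)).comp (ι i) = φ i) ∧
    (∀ z : L, ∃ i, z ∈ (φ i).range) ∧
    (∀ g, (ℒ g : Set L) = ⋃ i, (φ i) '' (𝒜 i g))

namespace IsGrading

variable {F : Type} [Field F] {G : Type} [CommGroup G] [DecidableEq G]
  {A : Type} [Ring A] [Algebra F A] {𝒜 : G → Submodule F A}

/-- The inverse of a homogeneous unit is homogeneous, of inverse degree. -/
theorem inv_mem (h𝒜 : IsGrading F 𝒜) {g : G} {u : Aˣ} (hu : (u : A) ∈ 𝒜 g) :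
    ((u⁻¹ : Aˣ) : A) ∈ 𝒜 g⁻¹ := by
  obtain ⟨hone, hmul, hint⟩ := h𝒜
  let : DirectSum.Decomposition 𝒜 := hint.chooseDecomposition
  have key : ∀ x : A, (DirectSum.decompose 𝒜 (u * x) 1 : A) =
      u * (DirectSum.decompose 𝒜 x g⁻¹ : A) := by
    intro x
    induction x using DirectSum.Decomposition.inductionOn 𝒜 with
    | zero => simp
    | @homogeneous h m =>
      have hm := hmul hu m.2
      by_cases hh : h = g⁻¹
      · subst hh
        rw [DirectSum.decompose_of_mem_same 𝒜 m.2]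
        rw [mul_inv_cancel] at hm
        exact DirectSum.decompose_of_mem_same 𝒜 hm
      · rw [DirectSum.decompose_of_mem_ne 𝒜 m.2 hh, mul_zero]
        exact DirectSum.decompose_of_mem_ne 𝒜 hm fun h1 => hh (eq_inv_of_mul_eq_one_right h1)
    | add x y hx hy =>
      simp only [mul_add, DirectSum.decompose_add, DirectSum.add_apply, Submodule.coe_add, hx, hy]
  have h1 := key (u⁻¹ : Aˣ)
  rw [Units.mul_inv, DirectSum.decompose_of_mem_same 𝒜 hone] at h1
  rw [Units.inv_eq_of_mul_eq_one_right h1.symm]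
  exact SetLike.coe_mem _

/-- Conjugation by a homogeneous unit preserves the homogeneous components. -/
theorem conj_mem (h𝒜 : IsGrading F 𝒜) {g h : G} {u : Aˣ} (hu : (u : A) ∈ 𝒜 g) {a : A}
    (ha : a ∈ 𝒜 h) : u * a * ((u⁻¹ : Aˣ) : A) ∈ 𝒜 h := by
  simpa using h𝒜.2.1 (h𝒜.2.1 hu ha) (h𝒜.inv_mem hu)

end IsGrading

/-- Conjugation by a unit, as an algebra automorphism. -/
def conjAlgEquiv (F : Type) [Field F] {A : Type} [Ring A] [Algebra F A] (u : Aˣ) : A ≃ₐ[F] A :=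
  MulSemiringAction.toAlgEquiv F A (ConjAct.toConjAct u)

theorem conjAlgEquiv_apply (F : Type) [Field F] {A : Type} [Ring A] [Algebra F A] (u : Aˣ)
    (a : A) : conjAlgEquiv F u a = u * a * ((u⁻¹ : Aˣ) : A) := rfl

namespace IsGradedDirectLimit

variable {F : Type} [Field F] {G : Type} [CommGroup G]
  {A : ℕ → Type} [∀ i, Ring (A i)] [∀ i, Algebra F (A i)]
  {𝒜 : ∀ i, G → Submodule F (A i)} {ι ι' : ∀ i, A i →ₐ[F] A (i + 1)}
  {L : Type} [Ring L] [Algebra F L] {ℒ : G → Submodule F L}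
  {L' : Type} [Ring L'] [Algebra F L'] {ℒ' : G → Submodule F L'}

/-- A graded direct limit is also a graded direct limit of any chain isomorphic to the
original one. -/
theorem of_equiv (e : ∀ i, A i ≃ₐ[F] A i) (he : ∀ i g, (e i) '' (𝒜 i g) = 𝒜 i g)
    (hcomm : ∀ i a, e (i + 1) (ι i a) = ι' i (e i a))
    (hL : IsGradedDirectLimit F A 𝒜 ι' ℒ) : IsGradedDirectLimit F A 𝒜 ι ℒ := by
  obtain ⟨φ, hinj, hcomp, hsurj, hgr⟩ := hL
  refine ⟨fun i => (φ i).comp (e i : A i →ₐ[F] A i), fun i => ?_, fun i => ?_, fun z => ?_,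
    fun g => ?_⟩
  · simpa using hinj i
  · ext a
    simpa [hcomm] using DFunLike.congr_fun (hcomp i) (e i a)
  · obtain ⟨i, a, rfl⟩ := hsurj z
    exact ⟨i, (e i).symm a, by simp⟩
  · rw [hgr]
    refine Set.iUnion_congr fun i => ?_
    conv_lhs => rw [← he i g, Set.image_image]
    rfl

/-- Graded direct limits of a chain are unique up to graded isomorphism. -/
theorem isGradedAlgIso (hL : IsGradedDirectLimit F A 𝒜 ι ℒ)
    (hL' : IsGradedDirectLimit F A 𝒜 ι ℒ') : IsGradedAlgIso F ℒ ℒ' := by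
  obtain ⟨φ, hinj, hcomp, hsurj, hgr⟩ := hL
  obtain ⟨φ', hinj', hcomp', hsurj', hgr'⟩ := hL'
  let R : ℕ → Subalgebra F (L × L') := fun i => ((φ i).prod (φ' i)).range
  have hmono : Monotone R := by
    refine monotone_nat_of_le_succ fun i => ?_
    rintro _ ⟨a, rfl⟩
    exact ⟨ι i a, Prod.ext (DFunLike.congr_fun (hcomp i) a) (DFunLike.congr_fun (hcomp' i) a)⟩
  let S : Subalgebra F (L × L') := ⨆ i, R i
  have hmem (z : L × L') : z ∈ S ↔ ∃ i, ∃ a, (φ i a, φ' i a) = z := by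
    rw [← SetLike.mem_coe, Subalgebra.coe_iSup_of_directed hmono.directed_le, Set.mem_iUnion]
    rfl
  have hS (i : ℕ) (a : A i) : (φ i a, φ' i a) ∈ S := (hmem _).2 ⟨i, a, rfl⟩
  let p : S →ₐ[F] L := (AlgHom.fst F L L').comp S.val
  let q : S →ₐ[F] L' := (AlgHom.snd F L L').comp S.val
  have hp : Function.Bijective p := by
    refine ⟨(injective_iff_map_eq_zero p).2 ?_, fun z => ?_⟩
    · rintro ⟨z, hz⟩ h0
      obtain ⟨i, a, rfl⟩ := (hmem z).1 hz
      obtain rfl : a = 0 := (map_eq_zero_iff (φ i) (hinj i)).1 h0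
      exact Subtype.ext (by simp)
    · obtain ⟨i, a, rfl⟩ := hsurj z
      exact ⟨⟨_, hS i a⟩, rfl⟩
  have hq : Function.Bijective q := by
    refine ⟨(injective_iff_map_eq_zero q).2 ?_, fun z => ?_⟩
    · rintro ⟨z, hz⟩ h0
      obtain ⟨i, a, rfl⟩ := (hmem z).1 hz
      obtain rfl : a = 0 := (map_eq_zero_iff (φ' i) (hinj' i)).1 h0
      exact Subtype.ext (by simp)
    · obtain ⟨i, a, rfl⟩ := hsurj' z
      exact ⟨⟨_, hS i a⟩, rfl⟩
  let e : L ≃ₐ[F] L' := (AlgEquiv.ofBijective p hp).symm.trans (AlgEquiv.ofBijective q hq)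
  have he (i : ℕ) (a : A i) : e (φ i a) = φ' i a := by
    have h : (AlgEquiv.ofBijective p hp).symm (φ i a) = ⟨_, hS i a⟩ :=
      (AlgEquiv.symm_apply_eq _).2 rfl
    simp only [e, AlgEquiv.trans_apply, h]
    rfl
  refine ⟨e, fun g => SetLike.coe_injective ?_⟩
  rw [Submodule.map_coe, hgr, hgr', Set.image_iUnion]
  refine Set.iUnion_congr fun i => ?_
  rw [Set.image_image]
  exact Set.image_congr fun a _ => he i a

end IsGradedDirectLimit

/-- If two chains of unital graded embeddings on the same graded algebras
differ by inner automorphisms given by homogeneous invertible elements, then their graded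
direct limits are isomorphic as `G`-graded algebras. -/
theorem directLimit_iso_of_equivalent_embeddings
    {F : Type} [Field F] {G : Type} [CommGroup G] [DecidableEq G]
    (A : ℕ → Type) [∀ i, Ring (A i)] [∀ i, Algebra F (A i)]
    (𝒜 : ∀ i, G → Submodule F (A i)) (h𝒜 : ∀ i, IsGrading F (𝒜 i))
    (ι ι' : ∀ i, A i →ₐ[F] A (i + 1))
    (hinj : ∀ i, Function.Injective (ι i))
    (hgr : ∀ i, IsGradedHom F (𝒜 i) (𝒜 (i + 1)) (ι i))
    (hconj : ∀ i, ∃ (g : G) (u : (A (i + 1))ˣ), (u : A (i + 1)) ∈ 𝒜 (i + 1) g ∧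
      ∀ a : A i, ι' i a = u * ι i a * ↑u⁻¹)
    {L : Type} [Ring L] [Algebra F L] (ℒ : G → Submodule F L)
    {L' : Type} [Ring L'] [Algebra F L'] (ℒ' : G → Submodule F L')
    (hL : IsGradedDirectLimit F A 𝒜 ι ℒ) (hL' : IsGradedDirectLimit F A 𝒜 ι' ℒ') :
    IsGradedAlgIso F ℒ ℒ' := by
  choose g u hu hconj using hconj
  let c : ∀ i, (A i)ˣ := fun i =>
    Nat.rec (motive := fun i => (A i)ˣ) 1 (fun i v => u i * Units.map (ι i : A i →* A (i + 1)) v) i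
  have hc_succ (i : ℕ) : c (i + 1) = u i * Units.map (ι i : A i →* A (i + 1)) (c i) := rfl
  have hc (i : ℕ) : ∃ h, (c i : A i) ∈ 𝒜 i h := by
    induction i with
    | zero => exact ⟨1, (h𝒜 0).1⟩
    | succ i ih =>
      obtain ⟨h, hh⟩ := ih
      exact ⟨g i * h, (h𝒜 (i + 1)).2.1 (hu i) (hgr i h ⟨_, hh, rfl⟩)⟩
  refine hL.isGradedAlgIso (hL'.of_equiv (fun i => conjAlgEquiv F (c i)) (fun i k => ?_)
    fun i a => ?_)
  · obtain ⟨h, hh⟩ := hc i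
    refine Set.Subset.antisymm ?_ fun a ha => ?_
    · rintro _ ⟨a, ha, rfl⟩
      exact (h𝒜 i).conj_mem hh ha
    · refine ⟨_, (h𝒜 i).conj_mem ((h𝒜 i).inv_mem hh) ha, ?_⟩
      simp [conjAlgEquiv_apply, mul_assoc]
  · simp only [conjAlgEquiv_apply, hconj, hc_succ, mul_inv_rev, Units.val_mul, ← map_inv,
      Units.coe_map, map_mul, mul_assoc]
    rfl
end
end

section
/- Let G be a finite abelian group and F an algebraically closed field. Every direct limit of matrix algebras over F endowed with elementary G-gradings is graded-isomorphic to a limit in standard form: a limit M_{x_0} \to M_{x_1} \to ... with labels a_i, such that supp(a_i) = S for a fixed subset S of \hat{G}/\Gamma independent of i, and supp(x_0) \subseteq S. -/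
noncomputable section

open scoped TensorProduct

/-- Evaluation of a complex character of `G` on a multiset (an element of `ℤ≥0 G`). -/
def evChar {G : Type} [CommGroup G] (χ : G →* ℂˣ) (x : Multiset G) : ℂ :=
  (x.map fun g => (χ g : ℂ)).sum

/-- The support of an element of `ℤ≥0 G ⊆ ℚG`, recorded as the (Galois-stable) set of
characters not vanishing on it; it corresponds to the set of Wedderburn components of `ℚG`
on which the element has nonzero projection. -/
def suppM {G : Type} [CommGroup G] (x : Multiset G) : Set (G →* ℂˣ) :=
  {χ | evChar χ x ≠ 0}
/-- The unital embedding `ι : M_γ(F) → M_δ(F)` of elementarily graded matrix algebras has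
label `η`: the centralizer of its image, with the induced grading, is graded-isomorphic to
the matrix algebra with elementary grading `η`. -/
def HasLabel {F : Type} [Field F] {G : Type} [CommGroup G] [DecidableEq G]
    {n m k : ℕ} (γ : Fin n → G) (δ : Fin m → G) (η : Fin k → G)
    (ι : Matrix (Fin n) (Fin n) F →ₐ[F] Matrix (Fin m) (Fin m) F) : Prop :=
  IsGradedHom F (elemGrading γ) (elemGrading δ) ι ∧
  IsGradedAlgIso F
    (subGrading (Subalgebra.centralizer F (Set.range ι)) (elemGrading δ))
    (elemGrading η)

/-- `(L, ℒ)` is the direct limit `M_{x 0} ⊗ ⊗_{i} M_{a i}` of matrix algebras with elementary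
`G`-gradings: the `i`-th algebra is `M_{x i}(F)` and the `i`-th unital graded embedding
has label `a i`, so that `x (i+1) = x i * a i`. -/
def IsElemLimit (F : Type) [Field F] {G : Type} [CommGroup G] [DecidableEq G]
    (L : Type) [Ring L] [Algebra F L] (ℒ : G → Submodule F L)
    (x a : ℕ → Multiset G) : Prop :=
  (∀ i, x (i + 1) = mmul (x i) (a i)) ∧
  ∃ (n : ℕ → ℕ) (γ : ∀ i, Fin (n i) → G) (k : ℕ → ℕ) (η : ∀ i, Fin (k i) → G)
    (ι : ∀ i, Matrix (Fin (n i)) (Fin (n i)) F →ₐ[F]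
      Matrix (Fin (n (i + 1))) (Fin (n (i + 1))) F),
    (∀ i, Reps (γ i) (x i)) ∧ (∀ i, Reps (η i) (a i)) ∧
    (∀ i, Function.Injective (ι i)) ∧
    (∀ i, HasLabel (γ i) (γ (i + 1)) (η i) (ι i)) ∧
    IsGradedDirectLimit F _ (fun i => elemGrading (γ i)) ι ℒ

/-- `(L, ℒ)` is a direct limit of matrix algebras over `F` endowed with (arbitrary)
`G`-gradings, along unital graded embeddings. -/
def IsMatrixLimit (F : Type) [Field F] {G : Type} [CommGroup G] [DecidableEq G]
    (L : Type) [Ring L] [Algebra F L] (ℒ : G → Submodule F L) : Prop :=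
  ∃ (n : ℕ → ℕ) (Mg : ∀ i, G → Submodule F (Matrix (Fin (n i)) (Fin (n i)) F))
    (ι : ∀ i, Matrix (Fin (n i)) (Fin (n i)) F →ₐ[F]
      Matrix (Fin (n (i + 1))) (Fin (n (i + 1))) F),
    (∀ i, IsGrading F (Mg i)) ∧
    (∀ i, IsGradedHom F (Mg i) (Mg (i + 1)) (ι i)) ∧
    IsGradedDirectLimit F _ Mg ι ℒ

/-- `(L, ℒ)` is a direct limit of matrix algebras over `F` endowed with elementary
`G`-gradings, along unital graded embeddings. -/
def IsElemMatrixLimit (F : Type) [Field F] {G : Type} [CommGroup G] [DecidableEq G]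
    (L : Type) [Ring L] [Algebra F L] (ℒ : G → Submodule F L) : Prop :=
  ∃ (n : ℕ → ℕ) (γ : ∀ i, Fin (n i) → G)
    (ι : ∀ i, Matrix (Fin (n i)) (Fin (n i)) F →ₐ[F]
      Matrix (Fin (n (i + 1))) (Fin (n (i + 1))) F),
    (∀ i, Function.Injective (ι i)) ∧
    (∀ i, IsGradedHom F (elemGrading (γ i)) (elemGrading (γ (i + 1))) (ι i)) ∧
    IsGradedDirectLimit F _ (fun i => elemGrading (γ i)) ι ℒ

theorem mem_elemGrading {F : Type} [Field F] {G : Type} [CommGroup G] [DecidableEq G]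
    {ι : Type} {γ : ι → G} {g : G} {M : Matrix ι ι F} :
    M ∈ elemGrading γ g ↔ ∀ i j, γ i ≠ g * γ j → M i j = 0 := by
  have key : ∀ i j, (γ i)⁻¹ * g * γ j = 1 ↔ γ i = g * γ j := fun i j => by
    rw [mul_assoc, inv_mul_eq_one]
  change (∀ i j, M i j ∈ trivGrading F G ((γ i)⁻¹ * g * γ j)) ↔ _
  refine forall₂_congr fun i j => ?_
  unfold trivGrading
  split_ifs with h
  · simp [(key i j).1 h]
  · simp [mt (key i j).2 h]

theorem mul_mem_elemGrading {F : Type} [Field F] {G : Type} [CommGroup G] [DecidableEq G]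
    {ι : Type} [Fintype ι] {γ : ι → G} {g h : G} {M N : Matrix ι ι F}
    (hM : M ∈ elemGrading γ g) (hN : N ∈ elemGrading γ h) : M * N ∈ elemGrading γ (g * h) := by
  rw [mem_elemGrading] at *
  intro i j hij
  rw [Matrix.mul_apply]
  refine Finset.sum_eq_zero fun l _ => ?_
  by_cases h₁ : γ i = g * γ l
  · rw [hN l j fun h₂ => hij (by rw [h₁, h₂, mul_assoc]), mul_zero]
  · rw [hM i l h₁, zero_mul]

/-- The projection of a matrix onto its homogeneous component of degree `g`. -/
def elemComponent (F : Type) [Field F] {G : Type} [CommGroup G] [DecidableEq G]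
    {ι : Type} (γ : ι → G) (g : G) : Matrix ι ι F →ₗ[F] Matrix ι ι F where
  toFun M := Matrix.of fun i j => if γ i = g * γ j then M i j else 0
  map_add' M N := by ext i j; by_cases h : γ i = g * γ j <;> simp [h]
  map_smul' c M := by ext i j; by_cases h : γ i = g * γ j <;> simp [h]

section elemComponent

variable {F : Type} [Field F] {G : Type} [CommGroup G] [DecidableEq G] {ι : Type} {γ : ι → G}

theorem elemComponent_apply (g : G) (M : Matrix ι ι F) (i j : ι) :
    elemComponent F γ g M i j = if γ i = g * γ j then M i j else 0 := rfl

theorem elemComponent_mem (g : G) (M : Matrix ι ι F) :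
    elemComponent F γ g M ∈ elemGrading γ g :=
  mem_elemGrading.2 fun _ _ h => by rw [elemComponent_apply, if_neg h]

theorem elemComponent_of_mem {g : G} {M : Matrix ι ι F} (hM : M ∈ elemGrading γ g) :
    elemComponent F γ g M = M := by
  ext i j
  rw [elemComponent_apply]
  split_ifs with h
  · rfl
  · exact (mem_elemGrading.1 hM i j h).symm

theorem elemComponent_of_mem_of_ne {g h : G} (hgh : g ≠ h) {M : Matrix ι ι F}
    (hM : M ∈ elemGrading γ h) : elemComponent F γ g M = 0 := by
  ext i j
  rw [elemComponent_apply]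
  split_ifs with hij
  · exact mem_elemGrading.1 hM i j fun h' => hgh (mul_right_cancel (hij.symm.trans h'))
  · rfl

theorem sum_elemComponent [Fintype G] (M : Matrix ι ι F) :
    ∑ g, elemComponent F γ g M = M := by
  ext i j
  rw [Matrix.sum_apply, Finset.sum_eq_single (γ i * (γ j)⁻¹)]
  · simp [elemComponent_apply]
  · intro g _ hg
    rw [elemComponent_apply, if_neg fun h => hg (by rw [h, mul_inv_cancel_right])]
  · simp

end elemComponent

/-- An algebra isomorphism from an elementarily graded matrix algebra onto a subalgebra of another
one is a graded isomorphism as soon as it maps each component into the corresponding one. -/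
theorem isGradedAlgIso_subGrading_of_le {F : Type} [Field F] {G : Type} [CommGroup G] [Fintype G]
    [DecidableEq G] {ι κ : Type} [Fintype ι] [DecidableEq ι] [Fintype κ] [DecidableEq κ]
    {γ : ι → G} {δ : κ → G} {D : Subalgebra F (Matrix κ κ F)} (e : Matrix ι ι F ≃ₐ[F] D)
    (he : ∀ g, ∀ M ∈ elemGrading γ g, (e M : Matrix κ κ F) ∈ elemGrading δ g) :
    IsGradedAlgIso F (subGrading D (elemGrading δ)) (elemGrading γ) := by
  refine ⟨e.symm, fun g => le_antisymm ?_ ?_⟩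
  · rintro _ ⟨r, hr, rfl⟩
    change (r : Matrix κ κ F) ∈ elemGrading δ g at hr
    have h₁ : (r : Matrix κ κ F) = e (elemComponent F γ g (e.symm r)) := by
      let E : Matrix ι ι F →ₗ[F] Matrix κ κ F := D.val.toLinearMap ∘ₗ e.toLinearMap
      have hE : (r : Matrix κ κ F) = E (∑ h, elemComponent F γ h (e.symm r)) := by
        rw [sum_elemComponent]
        simp [E]
      rw [← elemComponent_of_mem hr]
      conv_lhs => rw [hE, map_sum, map_sum]
      rw [Finset.sum_eq_single g]
      · exact elemComponent_of_mem (he g _ (elemComponent_mem g _))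
      · exact fun h _ hne =>
          elemComponent_of_mem_of_ne hne.symm (he h _ (elemComponent_mem h _))
      · simp
    have h₂ : e.symm r = elemComponent F γ g (e.symm r) := by
      conv_lhs => rw [Subtype.ext h₁, AlgEquiv.symm_apply_apply]
    change e.symm r ∈ elemGrading γ g
    rw [h₂]
    exact elemComponent_mem g _
  · exact fun M hM => ⟨e M, he g M hM, e.symm_apply_apply M⟩

section MatrixUnits

variable {F : Type} [Field F] {R : Type} [Ring R] [Algebra F R] {ι : Type} [Fintype ι]
  [DecidableEq ι]

/-- The coefficients of an element of an algebra with respect to the matrix units given by a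
homomorphism from a matrix algebra. -/
def unitCoeff (φ : Matrix ι ι F →ₐ[F] R) (r : R) (i j : ι) : R :=
  ∑ l, φ (Matrix.single l i 1) * r * φ (Matrix.single j l 1)

theorem commute_of_commute_single (φ : Matrix ι ι F →ₐ[F] R) {c : R}
    (h : ∀ i j, Commute (φ (Matrix.single i j 1)) c) (M : Matrix ι ι F) : Commute (φ M) c := by
  rw [Matrix.matrix_eq_sum_single M]
  simp only [map_sum]
  refine Commute.sum_left _ _ _ fun i _ => Commute.sum_left _ _ _ fun j _ => ?_
  have : Matrix.single i j (M i j) = M i j • Matrix.single i j (1 : F) := by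
    rw [Matrix.smul_single, smul_eq_mul, mul_one]
  rw [this, map_smul]
  exact (h i j).smul_left _

theorem commute_unitCoeff (φ : Matrix ι ι F →ₐ[F] R) (r : R) (i j : ι) (M : Matrix ι ι F) :
    Commute (φ M) (unitCoeff φ r i j) := by
  refine commute_of_commute_single φ (fun a b => ?_) M
  have h₁ : φ (Matrix.single a b 1) * unitCoeff φ r i j =
      φ (Matrix.single a i 1) * r * φ (Matrix.single j b 1) := by
    rw [unitCoeff, Finset.mul_sum, Finset.sum_eq_single b]
    · rw [← mul_assoc, ← mul_assoc, ← map_mul, Matrix.single_mul_single_same, mul_one]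
    · intro l _ hl
      rw [← mul_assoc, ← mul_assoc, ← map_mul, Matrix.single_mul_single_of_ne _ _ _ _ hl.symm,
        map_zero, zero_mul, zero_mul]
    · simp
  have h₂ : unitCoeff φ r i j * φ (Matrix.single a b 1) =
      φ (Matrix.single a i 1) * r * φ (Matrix.single j b 1) := by
    rw [unitCoeff, Finset.sum_mul, Finset.sum_eq_single a]
    · rw [mul_assoc, ← map_mul, Matrix.single_mul_single_same, mul_one]
    · intro l _ hl
      rw [mul_assoc, ← map_mul, Matrix.single_mul_single_of_ne _ _ _ _ hl, map_zero, mul_zero]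
    · simp
  exact h₁.trans h₂.symm

theorem sum_single_mul_unitCoeff (φ : Matrix ι ι F →ₐ[F] R) (r : R) :
    ∑ i, ∑ j, φ (Matrix.single i j 1) * unitCoeff φ r i j = r := by
  have h : ∀ i j, φ (Matrix.single i j 1) * unitCoeff φ r i j =
      φ (Matrix.single i i 1) * r * φ (Matrix.single j j 1) := fun i j => by
    rw [unitCoeff, Finset.mul_sum, Finset.sum_eq_single j]
    · rw [← mul_assoc, ← mul_assoc, ← map_mul, Matrix.single_mul_single_same, mul_one]
    · intro l _ hl
      rw [← mul_assoc, ← mul_assoc, ← map_mul, Matrix.single_mul_single_of_ne _ _ _ _ hl.symm,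
        map_zero, zero_mul, zero_mul]
    · simp
  have hone : ∑ i, φ (Matrix.single i i 1) = 1 := by
    rw [← map_sum, Matrix.sum_single_one, map_one]
  simp_rw [h, ← Finset.mul_sum, ← Finset.sum_mul, hone, mul_one, one_mul]

theorem commute_unitCoeff_of_commute (φ : Matrix ι ι F →ₐ[F] R) {r c : R}
    (hr : Commute c r) (hφ : ∀ M, Commute c (φ M)) (i j : ι) : Commute c (unitCoeff φ r i j) :=
  Commute.sum_right _ _ _ fun _ _ => ((hφ _).mul_right hr).mul_right (hφ _)

end MatrixUnits

/-- The tuple of products of the entries of two tuples. -/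
def mulTuple {G : Type} [CommGroup G] {k l : ℕ} (η : Fin k → G) (θ : Fin l → G) (p : Fin (k * l)) : G :=
  η (finProdFinEquiv.symm p).1 * θ (finProdFinEquiv.symm p).2

theorem reps_mulTuple {G : Type} [CommGroup G] {k l : ℕ} {η : Fin k → G} {θ : Fin l → G} {x y : Multiset G}
    (hη : Reps η x) (hθ : Reps θ y) : Reps (mulTuple η θ) (mmul x y) := by
  unfold Reps at *
  subst hη hθ
  have h : (Finset.univ : Finset (Fin (k * l))) =
      (Finset.univ : Finset (Fin k × Fin l)).map finProdFinEquiv.toEmbedding := by simp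
  rw [h, Finset.map_val, Multiset.map_map, ← Finset.univ_product_univ, Finset.product_val]
  simp [mmul, Multiset.bind_map, SProd.sprod, Multiset.product, Multiset.map_bind,
    Function.comp_def, mulTuple]

section Label

variable {F : Type} [Field F] {G : Type} [CommGroup G] [DecidableEq G]

/-- A label of `f` yields a graded parametrization of the centralizer of the image of `f`. -/
theorem HasLabel.exists_param {n m k : ℕ} {γ : Fin n → G} {δ : Fin m → G} {η : Fin k → G}
    {f : Matrix (Fin n) (Fin n) F →ₐ[F] Matrix (Fin m) (Fin m) F} (h : HasLabel γ δ η f) :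
    ∃ u : Matrix (Fin k) (Fin k) F →ₐ[F] Matrix (Fin m) (Fin m) F,
      Function.Injective u ∧ (∀ g, ∀ M ∈ elemGrading η g, u M ∈ elemGrading δ g) ∧
      (∀ M N, Commute (f N) (u M)) ∧ ∀ c, (∀ N, Commute (f N) c) → ∃ M, u M = c := by
  obtain ⟨-, e, he⟩ := h
  refine ⟨(Subalgebra.val _).comp e.symm.toAlgHom, ?_, fun g M hM => ?_, fun M N => ?_,
    fun c hc => ?_⟩
  · exact Subtype.val_injective.comp e.symm.injective
  · rw [← he g] at hM
    obtain ⟨r, hr, rfl⟩ := hM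
    change ((e.symm (e r) : _) : Matrix (Fin m) (Fin m) F) ∈ elemGrading δ g
    rw [AlgEquiv.symm_apply_apply]
    exact hr
  · exact Subalgebra.mem_centralizer_iff F |>.1 (e.symm M).2 (f N) ⟨N, rfl⟩
  · have hmem : c ∈ Subalgebra.centralizer F (Set.range f) := by
      rw [Subalgebra.mem_centralizer_iff]
      rintro _ ⟨N, rfl⟩
      exact hc N
    refine ⟨e ⟨c, hmem⟩, ?_⟩
    change ((e.symm (e ⟨c, hmem⟩) : _) : Matrix (Fin m) (Fin m) F) = c
    rw [AlgEquiv.symm_apply_apply]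

/-- The composite of two labelled embeddings is labelled by the product of the labels. -/
theorem HasLabel.comp [Fintype G] {n m p k l : ℕ} {γ : Fin n → G} {δ : Fin m → G} {ε : Fin p → G}
    {η : Fin k → G} {θ : Fin l → G}
    {f : Matrix (Fin n) (Fin n) F →ₐ[F] Matrix (Fin m) (Fin m) F}
    {f' : Matrix (Fin m) (Fin m) F →ₐ[F] Matrix (Fin p) (Fin p) F}
    (h : HasLabel γ δ η f) (h' : HasLabel δ ε θ f') :
    HasLabel γ ε (mulTuple η θ) (f'.comp f) := by
  have hf' : ∀ g, ∀ M ∈ elemGrading δ g, f' M ∈ elemGrading ε g :=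
    fun g M hM => h'.1 g ⟨M, hM, rfl⟩
  refine ⟨?_, ?_⟩
  · rintro g _ ⟨M, hM, rfl⟩
    exact hf' g _ (h.1 g ⟨M, hM, rfl⟩)
  obtain ⟨u, -, hu, huc, hus⟩ := h.exists_param
  obtain ⟨v, hvi, hv, hvc, hvs⟩ := h'.exists_param
  let w := f'.comp u
  have hw : ∀ g, ∀ M ∈ elemGrading η g, w M ∈ elemGrading ε g :=
    fun g M hM => hf' g _ (hu g M hM)
  let K := Matrix.kroneckerAlgEquiv (Fin k) (Fin l) F
  let E := Matrix.reindexAlgEquiv F F (finProdFinEquiv (m := k) (n := l))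
  let L := Algebra.TensorProduct.lift w v fun M N => hvc N (u M)
  let T := L.comp (K.trans E).symm.toAlgHom
  have hT : ∀ M N, T (E (K (M ⊗ₜ N))) = w M * v N := fun M N => by
    change L ((K.trans E).symm ((K.trans E) (M ⊗ₜ N))) = _
    rw [AlgEquiv.symm_apply_apply]
    exact Algebra.TensorProduct.lift_tmul _ _ _ _ _
  have hwc : ∀ M N, Commute (f' (f N)) (w M) := fun M N => (huc M N).map f'
  have hmem : ∀ M, T M ∈ Subalgebra.centralizer F (Set.range (f'.comp f)) := by
    intro M
    rw [Subalgebra.mem_centralizer_iff]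
    rintro _ ⟨N, rfl⟩
    obtain ⟨t, rfl⟩ := (K.trans E).surjective M
    change Commute (f' (f N)) (T (E (K t)))
    induction t using TensorProduct.induction_on with
    | zero => simp
    | tmul A B => rw [hT]; exact (hwc A N).mul_right (hvc B (f N))
    | add s t hs ht => simp only [map_add]; exact hs.add_right ht
  have hinj : Function.Injective T := by
    rcases isEmpty_or_nonempty (Fin (k * l)) with hk | hk
    · exact Function.injective_of_subsingleton _
    · have : Nonempty (Fin l) := hk.map fun i => (finProdFinEquiv.symm i).2
      have : Nontrivial (Matrix (Fin p) (Fin p) F) := hvi.nontrivial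
      exact T.toRingHom.injective
  have hsurj : ∀ r ∈ Subalgebra.centralizer F (Set.range (f'.comp f)), ∃ M, T M = r := by
    intro r hr
    have hrc : ∀ N, Commute (f' (f N)) r := fun N =>
      (Subalgebra.mem_centralizer_iff F).1 hr _ ⟨N, rfl⟩
    have hcoeff : ∀ i j, ∃ B, v B = unitCoeff w r i j := by
      refine fun i j => hvs _ fun b => ?_
      rw [← sum_single_mul_unitCoeff f b, map_sum]
      refine Commute.sum_left _ _ _ fun a _ => ?_
      rw [map_sum]
      refine Commute.sum_left _ _ _ fun c _ => ?_
      rw [map_mul]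
      refine Commute.mul_left ?_ ?_
      · exact commute_unitCoeff_of_commute w (hrc _) (fun M => hwc M _) i j
      · obtain ⟨A, hA⟩ := hus (unitCoeff f b a c) fun N => commute_unitCoeff f b a c N
        rw [← hA]
        exact commute_unitCoeff w r i j A
    choose B hB using hcoeff
    refine ⟨∑ i, ∑ j, E (K (Matrix.single i j 1 ⊗ₜ B i j)), ?_⟩
    simp_rw [map_sum, hT, hB]
    exact sum_single_mul_unitCoeff w r
  let e := AlgEquiv.ofBijective (T.codRestrict _ hmem)
    ⟨fun M N hMN => hinj (congrArg Subtype.val hMN), fun r => by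
      obtain ⟨M, hM⟩ := hsurj r r.2
      exact ⟨M, Subtype.ext hM⟩⟩
  refine isGradedAlgIso_subGrading_of_le e fun g M hM => ?_
  change T M ∈ elemGrading ε g
  have hsingle : ∀ i j a b, Matrix.single (finProdFinEquiv (i, a)) (finProdFinEquiv (j, b)) (1 : F)
      = E (K (Matrix.single i j 1 ⊗ₜ Matrix.single a b 1)) := by
    intro i j a b
    have : K (Matrix.single i j 1 ⊗ₜ Matrix.single a b 1) = Matrix.single (i, a) (j, b) (1 : F) := by
      simp [K, Matrix.single_kronecker_single]
    rw [this]
    ext p q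
    simp only [E, Matrix.coe_reindexAlgEquiv, Matrix.reindex_apply, Matrix.submatrix_apply,
      Matrix.single_apply, Equiv.eq_symm_apply]
  rw [Matrix.matrix_eq_sum_single M, map_sum]
  refine Submodule.sum_mem _ fun s _ => ?_
  rw [map_sum]
  refine Submodule.sum_mem _ fun t _ => ?_
  obtain ⟨⟨i, a⟩, rfl⟩ := finProdFinEquiv.surjective s
  obtain ⟨⟨j, b⟩, rfl⟩ := finProdFinEquiv.surjective t
  by_cases hst : mulTuple η θ (finProdFinEquiv (i, a)) =
      g * mulTuple η θ (finProdFinEquiv (j, b))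
  · set c := M (finProdFinEquiv (i, a)) (finProdFinEquiv (j, b))
    have hc : Matrix.single (finProdFinEquiv (i, a)) (finProdFinEquiv (j, b)) c =
        c • Matrix.single (finProdFinEquiv (i, a)) (finProdFinEquiv (j, b)) (1 : F) := by
      rw [Matrix.smul_single, smul_eq_mul, mul_one]
    rw [hc, map_smul, hsingle, hT]
    refine Submodule.smul_mem _ _ ?_
    have hmemSingle : ∀ {q : ℕ} (ζ : Fin q → G) (i j : Fin q),
        Matrix.single i j (1 : F) ∈ elemGrading ζ (ζ i * (ζ j)⁻¹) := fun ζ i j => by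
      refine mem_elemGrading.2 fun s t hst => Matrix.single_apply_of_ne _ _ _ _ _ ?_
      rintro ⟨rfl, rfl⟩
      exact hst (by rw [inv_mul_cancel_right])
    have hg : g = η i * (η j)⁻¹ * (θ a * (θ b)⁻¹) := by
      simp only [mulTuple, Equiv.symm_apply_apply] at hst
      rw [← mul_inv_eq_iff_eq_mul] at hst
      rw [← hst, mul_inv, mul_mul_mul_comm]
    rw [hg]
    exact mul_mem_elemGrading (hw _ _ (hmemSingle η i j)) (hv _ _ (hmemSingle θ a b))
  · rw [mem_elemGrading.1 hM _ _ hst, Matrix.single_zero, map_zero]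
    exact zero_mem _

end Label

theorem evChar_mmul {G : Type} [CommGroup G] (χ : G →* ℂˣ) (x y : Multiset G) :
    evChar χ (mmul x y) = evChar χ x * evChar χ y := by
  simp [evChar, mmul, Multiset.map_bind, Multiset.sum_bind, Multiset.sum_map_mul_left,
    Multiset.sum_map_mul_right]

theorem mem_suppM_mmul {G : Type} [CommGroup G] {χ : G →* ℂˣ} {x y : Multiset G} :
    χ ∈ suppM (mmul x y) ↔ χ ∈ suppM x ∧ χ ∈ suppM y := by
  simp [suppM, evChar_mmul]

theorem mmul_assoc {G : Type} [CommGroup G] (x y z : Multiset G) :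
    mmul (mmul x y) z = mmul x (mmul y z) := by
  simp [mmul, Multiset.bind_assoc, Multiset.map_bind, Multiset.bind_map, mul_assoc]

/-- The product of the `d + 1` consecutive terms of `a` starting with the `i`-th one. -/
def blockProd {G : Type} [CommGroup G] (a : ℕ → Multiset G) (i : ℕ) : ℕ → Multiset G
  | 0 => a i
  | d + 1 => mmul (blockProd a i d) (a (i + d + 1))

theorem mem_suppM_blockProd {G : Type} [CommGroup G] {a : ℕ → Multiset G} {i d : ℕ}
    {χ : G →* ℂˣ} : χ ∈ suppM (blockProd a i d) ↔ ∀ j ≤ d, χ ∈ suppM (a (i + j)) := by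
  induction d with
  | zero => simp [blockProd]
  | succ d ih =>
    rw [blockProd, mem_suppM_mmul, ih]
    constructor
    · rintro ⟨h₁, h₂⟩ j hj
      rcases Nat.le_succ_iff.1 hj with hj | rfl
      · exact h₁ j hj
      · exact h₂
    · exact fun h => ⟨fun j hj => h j (hj.trans d.le_succ), h (d + 1) le_rfl⟩

theorem eq_mmul_blockProd {G : Type} [CommGroup G] {x a : ℕ → Multiset G}
    (hx : ∀ i, x (i + 1) = mmul (x i) (a i)) (i d : ℕ) :
    x (i + d + 1) = mmul (x i) (blockProd a i d) := by
  induction d with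
  | zero => exact hx i
  | succ d ih =>
    change x (i + d + 1 + 1) = _
    rw [hx, ih, mmul_assoc, blockProd]

/-- Grouping the steps of a limit of elementarily graded matrix algebras into consecutive blocks,
after discarding an initial segment, does not change the limit. -/
theorem IsElemLimit.blocks {F : Type} [Field F] {G : Type} [CommGroup G] [Fintype G]
    [DecidableEq G] {L : Type} [Ring L] [Algebra F L] {ℒ : G → Submodule F L}
    {x a : ℕ → Multiset G} (h : IsElemLimit F L ℒ x a) (s d : ℕ → ℕ)
    (hs : ∀ i, s (i + 1) = s i + d i + 1) :
    IsElemLimit F L ℒ (fun i => x (s i)) (fun i => blockProd a (s i) (d i)) := by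
  obtain ⟨hx, n, γ, k, η, f, hγ, hη, hf, hlab, φ, hφ, hcomp, hrange, hgrade⟩ := h
  refine ⟨fun i => (congrArg x (hs i)).trans (eq_mmul_blockProd hx _ _), ?_⟩
  have hblock : ∀ i d, ∃ (l : ℕ) (θ : Fin l → G)
      (f' : Matrix (Fin (n i)) (Fin (n i)) F →ₐ[F]
        Matrix (Fin (n (i + d + 1))) (Fin (n (i + d + 1))) F),
      Reps θ (blockProd a i d) ∧ Function.Injective f' ∧
      HasLabel (γ i) (γ (i + d + 1)) θ f' ∧ (φ (i + d + 1)).comp f' = φ i := by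
    intro i d
    induction d with
    | zero => exact ⟨k i, η i, f i, hη i, hf i, hlab i, hcomp i⟩
    | succ d ih =>
      obtain ⟨l, θ, f', hθ, hf', hlab', hcomp'⟩ := ih
      refine ⟨_, mulTuple θ (η (i + d + 1)), (f (i + d + 1)).comp f',
        reps_mulTuple hθ (hη _), (hf _).comp hf', hlab'.comp (hlab _), ?_⟩
      rw [← AlgHom.comp_assoc]
      exact (congrArg (fun ψ => AlgHom.comp ψ f') (hcomp (i + d + 1))).trans hcomp'
  have hblock' : ∀ i, ∃ (l : ℕ) (θ : Fin l → G)
      (f' : Matrix (Fin (n (s i))) (Fin (n (s i))) F →ₐ[F]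
        Matrix (Fin (n (s (i + 1)))) (Fin (n (s (i + 1)))) F),
      Reps θ (blockProd a (s i) (d i)) ∧ Function.Injective f' ∧
      HasLabel (γ (s i)) (γ (s (i + 1))) θ f' ∧ (φ (s (i + 1))).comp f' = φ (s i) := by
    intro i
    rw [hs]
    exact hblock (s i) (d i)
  choose l θ f' hθ hf' hlab' hcomp' using hblock'
  have hle : ∀ i, i ≤ s i := by
    intro i
    induction i with
    | zero => exact Nat.zero_le _
    | succ i ih => rw [hs]; omega
  have hmono_range : Monotone fun i => Set.range (φ i) := monotone_nat_of_le_succ fun i => by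
    rintro _ ⟨M, rfl⟩
    exact ⟨f i M, congrArg (fun ψ => ψ M) (hcomp i)⟩
  have hmono_grade : ∀ g, Monotone fun i =>
      φ i '' (elemGrading (γ i) g : Submodule F (Matrix (Fin (n i)) (Fin (n i)) F)) := fun g =>
    monotone_nat_of_le_succ fun i => by
      rintro _ ⟨M, hM, rfl⟩
      exact ⟨f i M, (hlab i).1 g ⟨M, hM, rfl⟩, congrArg (fun ψ => ψ M) (hcomp i)⟩
  refine ⟨fun i => n (s i), fun i => γ (s i), l, θ, f', fun i => hγ _, hθ, hf', hlab',
    fun i => φ (s i), fun i => hφ _, hcomp', fun z => ?_, fun g => ?_⟩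
  · obtain ⟨i, hi⟩ := hrange z
    exact ⟨i, hmono_range (hle i) hi⟩
  · rw [hgrade g]
    exact Set.Subset.antisymm
      (Set.iUnion_subset fun i => (hmono_grade g (hle i)).trans
        (Set.subset_iUnion (fun i => φ (s i) '' (elemGrading (γ (s i)) g :
          Submodule F (Matrix (Fin (n (s i))) (Fin (n (s i))) F))) i))
      (Set.iUnion_subset fun i => Set.subset_iUnion (fun i => φ i '' (elemGrading (γ i) g :
          Submodule F (Matrix (Fin (n i)) (Fin (n i)) F))) (s i))

/-- Over an algebraically closed field and a finite abelian group `G`,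
every direct limit of matrix algebras with elementary `G`-gradings is (graded-isomorphic to)
a limit in standard form: the labels `a' i` all have the same support `S` and the support
of the initial multiset `x' 0` is contained in `S`. -/
theorem elemLimit_standard_form
    {F : Type} [Field F] [IsAlgClosed F] {G : Type} [CommGroup G] [Fintype G] [DecidableEq G]
    {L : Type} [Ring L] [Algebra F L] (ℒ : G → Submodule F L) (hgr : IsGrading F ℒ)
    (x a : ℕ → Multiset G) (h : IsElemLimit F L ℒ x a) :
    ∃ (x' a' : ℕ → Multiset G) (S : Set (G →* ℂˣ)),
      (∀ i, suppM (a' i) = S) ∧ suppM (x' 0) ⊆ S ∧ IsElemLimit F L ℒ x' a' := by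
  let S : Set (G →* ℂˣ) := {χ | ∀ᶠ i in Filter.atTop, χ ∈ suppM (a i)}
  obtain ⟨N, hN⟩ : ∃ N, ∀ i ≥ N, ∀ χ ∈ S, χ ∈ suppM (a i) := by
    rw [← Filter.eventually_atTop, Filter.eventually_all]
    exact fun χ => Filter.eventually_imp_distrib_left.2 id
  have hmiss : ∀ i, ∃ d, ∀ χ ∉ S, χ ∉ suppM (blockProd a i d) := by
    intro i
    have : ∀ χ, ∀ᶠ d in Filter.atTop, χ ∉ S → χ ∉ suppM (blockProd a i d) := by
      refine fun χ => Filter.eventually_imp_distrib_left.2 fun hχ => ?_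
      obtain ⟨j, hij, hj⟩ := Filter.frequently_atTop.1 (Filter.not_eventually.1 hχ) i
      obtain ⟨j, rfl⟩ := Nat.exists_eq_add_of_le hij
      exact Filter.eventually_atTop.2 ⟨j, fun d hd h' => hj (mem_suppM_blockProd.1 h' j hd)⟩
    exact (Filter.eventually_all.2 this).exists
  choose d hd using hmiss
  let s : ℕ → ℕ := Nat.rec (N + d N + 1) fun _ m => m + d m + 1
  have hs : ∀ i, N ≤ s i := by
    intro i
    induction i with
    | zero => exact (Nat.le_add_right N (d N)).trans (Nat.le_succ _)
    | succ i ih => exact ih.trans ((Nat.le_add_right (s i) (d (s i))).trans (Nat.le_succ _))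
  refine ⟨_, _, S, fun i => ?_, ?_, h.blocks s (fun i => d (s i)) fun i => rfl⟩
  · ext χ
    refine ⟨fun hχ => by_contra fun hS => hd (s i) χ hS hχ, fun hS => ?_⟩
    exact mem_suppM_blockProd.2 fun j _ => hN _ ((hs i).trans (Nat.le_add_right _ _)) χ hS
  · intro χ hχ
    change χ ∈ suppM (x (N + d N + 1)) at hχ
    rw [eq_mmul_blockProd h.1, mem_suppM_mmul] at hχ
    exact by_contra fun hS => hd N χ hS hχ.2
end
end
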